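/- (Commutation of the left and right cohomological Demazure–Lusztig operators.) For all integers i, j with 1 ≤ i, j ≤ n−1, T_i^L ∘ T_j^R = T_j^R ∘ T_i^L as operators on M, where T_i^L := −δ_i + s_i^L and T_j^R := ∂_j − s_j^R. -/

import Mathlib

open MvPolynomial Finset

noncomputable section

/-- The field `F = ℚ(x_1, …, x_n)`, realized as the fraction field of `ℚ[x_1,…,x_n]`,
with variables indexed by `Fin n` (so `x_a`, `1 ≤ a ≤ n`, corresponds to index `a-1`). -/
abbrev FF (n : ℕ) : Type := FractionRing (MvPolynomial (Fin n) ℚ)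

/-- The action of `S_n` on `F` by `ℚ`-algebra automorphisms permuting the variables,
`w · x_i = x_{w(i)}`. -/
noncomputable def wAct {n : ℕ} (w : Equiv.Perm (Fin n)) : FF n ≃+* FF n :=
  IsFractionRing.ringEquivOfRingEquiv (MvPolynomial.renameEquiv ℚ w).toRingEquiv

/-- The variable `x` (with a `Fin n` index) as an element of `F`. -/
noncomputable def xv {n : ℕ} (i : Fin n) : FF n :=
  algebraMap (MvPolynomial (Fin n) ℚ) (FF n) (MvPolynomial.X i)

/-- The localization model `M`: functions `S_n → F`, with pointwise operations. -/
abbrev MM (n : ℕ) : Type := Equiv.Perm (Fin n) → FF n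

/-- The left Weyl action `(w^L f)(u) = w · (f (w⁻¹ u))`. -/
noncomputable def leftW {n : ℕ} (w : Equiv.Perm (Fin n)) (f : MM n) : MM n :=
  fun u => wAct w (f (w⁻¹ * u))

/-- The right Weyl action `(w^R f)(u) = f (u w)`. -/
noncomputable def rightW {n : ℕ} (w : Equiv.Perm (Fin n)) (f : MM n) : MM n :=
  fun u => f (u * w)

/-- The simple transposition `s_i = (i, i+1)` (1-based index `i`, `1 ≤ i ≤ n-1`). -/
def sref {n : ℕ} (i : ℕ) (h1 : 1 ≤ i) (h2 : i ≤ n - 1) : Equiv.Perm (Fin n) :=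
  Equiv.swap ⟨i - 1, by omega⟩ ⟨i, by omega⟩

/-- The simple root `α_i = x_i - x_{i+1}` (1-based index). -/
noncomputable def alf {n : ℕ} (i : ℕ) (h1 : 1 ≤ i) (h2 : i ≤ n - 1) : FF n :=
  xv ⟨i - 1, by omega⟩ - xv ⟨i, by omega⟩

/-- The fixed-point class `ε_w ∈ M`:
`ε_w(u) = ∏_{a<b} (x_{w(b)} - x_{w(a)})` if `u = w`, and `0` otherwise. -/
noncomputable def eps {n : ℕ} (w : Equiv.Perm (Fin n)) : MM n := fun u =>
  if u = w then
    ∏ p ∈ Finset.univ.filter (fun p : Fin n × Fin n => p.1 < p.2), (xv (w p.2) - xv (w p.1))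
  else 0

/-- The equivariant Euler class `e_w = ∏_{a<b} (x_{w(b)} - x_{w(a)})`. -/
noncomputable def euler {n : ℕ} (w : Equiv.Perm (Fin n)) : FF n :=
  ∏ p ∈ Finset.univ.filter (fun p : Fin n × Fin n => p.1 < p.2), (xv (w p.2) - xv (w p.1))

/-- The Poincaré pairing `⟨f, g⟩ = Σ_w f(w) g(w) / e_w`. -/
noncomputable def pair {n : ℕ} (f g : MM n) : FF n :=
  ∑ w : Equiv.Perm (Fin n), f w * g w / euler w

/-- The right divided difference (BGG) operator `(∂_i f)(v) = (f(v) - f(v s_i)) / (-(v·α_i))`. -/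
noncomputable def rdd {n : ℕ} (i : ℕ) (h1 : 1 ≤ i) (h2 : i ≤ n - 1) (f : MM n) : MM n :=
  fun v => (f v - f (v * sref i h1 h2)) / (-(wAct v (alf i h1 h2)))

/-- The left divided difference operator `(δ_i f)(v) = (f(v) - s_i·(f(s_i v))) / α_i`. -/
noncomputable def ldd {n : ℕ} (i : ℕ) (h1 : 1 ≤ i) (h2 : i ≤ n - 1) (f : MM n) : MM n :=
  fun v => (f v - wAct (sref i h1 h2) (f (sref i h1 h2 * v))) / alf i h1 h2

/-- The left Demazure–Lusztig operator `T_i^L = -δ_i + s_i^L`. -/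
noncomputable def tL {n : ℕ} (i : ℕ) (h1 : 1 ≤ i) (h2 : i ≤ n - 1) (f : MM n) : MM n :=
  -(ldd i h1 h2 f) + leftW (sref i h1 h2) f

/-- The dual left Demazure–Lusztig operator `T_i^{L,∨} = δ_i + s_i^L`. -/
noncomputable def tLd {n : ℕ} (i : ℕ) (h1 : 1 ≤ i) (h2 : i ≤ n - 1) (f : MM n) : MM n :=
  ldd i h1 h2 f + leftW (sref i h1 h2) f

/-- The right Demazure–Lusztig operator `T_i^R = ∂_i - s_i^R`. -/
noncomputable def tR {n : ℕ} (i : ℕ) (h1 : 1 ≤ i) (h2 : i ≤ n - 1) (f : MM n) : MM n :=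
  rdd i h1 h2 f - rightW (sref i h1 h2) f

theorem wAct_mul_apply {n : ℕ} (v w : Equiv.Perm (Fin n)) (a : FF n) :
    wAct (v * w) a = wAct v (wAct w a) := by
  have h : (wAct (v * w) : FF n ≃+* FF n).toRingHom =
      (wAct v : FF n ≃+* FF n).toRingHom.comp (wAct w : FF n ≃+* FF n).toRingHom := by
    apply IsLocalization.ringHom_ext (nonZeroDivisors (MvPolynomial (Fin n) ℚ))
    ext p <;> simp [wAct]
  exact RingHom.congr_fun h a

theorem sref_inv {n : ℕ} (i : ℕ) (h1 : 1 ≤ i) (h2 : i ≤ n - 1) :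
    (sref i h1 h2)⁻¹ = sref i h1 h2 :=
  Equiv.swap_inv _ _

theorem wAct_sref_wAct_sref_mul {n : ℕ} (i : ℕ) (h1 : 1 ≤ i) (h2 : i ≤ n - 1)
    (v : Equiv.Perm (Fin n)) (a : FF n) :
    wAct (sref i h1 h2) (wAct (sref i h1 h2 * v) a) = wAct v a := by
  have h : sref i h1 h2 * (sref i h1 h2 * v) = v := by
    nth_rewrite 1 [← sref_inv]
    exact inv_mul_cancel_left _ _
  rw [← wAct_mul_apply, h]

/-- Commutation of the left and right cohomological Demazure–Lusztig operators:
`T_i^L ∘ T_j^R = T_j^R ∘ T_i^L`. -/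
theorem left_right_DL_commute
    (n : ℕ) (hn : 2 ≤ n) (i j : ℕ) (hi1 : 1 ≤ i) (hi2 : i ≤ n - 1)
    (hj1 : 1 ≤ j) (hj2 : j ≤ n - 1) (f : MM n) :
    tL i hi1 hi2 (tR j hj1 hj2 f) = tR j hj1 hj2 (tL i hi1 hi2 f) := by
  funext v
  simp only [tL, tR, ldd, rdd, leftW, rightW, Pi.add_apply, Pi.sub_apply, Pi.neg_apply,
    sref_inv, map_sub, map_div₀, map_neg, wAct_sref_wAct_sref_mul, mul_assoc]
  ring
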